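/- Suppose ω ≠ 1. Then Φ_re^ω is a (not necessarily reduced) root system in the fixed subspace E^ω; explicitly: Φ_re^ω is a finite subset of E^ω, 0 ∉ Φ_re^ω, Φ_re^ω spans E^ω, for all u, v ∈ Φ_re^ω the reflection s_u(v) lies in Φ_re^ω, and (u^∨, v) ∈ ℤ for all u, v ∈ Φ_re^ω. -/

import Mathlib

open scoped RealInnerProductSpace

namespace Folding

variable {E : Type*} [NormedAddCommGroup E] [InnerProductSpace ℝ E]

/-- The coroot `α^∨ = 2α/(α,α)` of a nonzero vector `α`. -/
noncomputable def coroot (α : E) : E := (2 / ⟪α, α⟫) • α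

/-- The reflection `s_α(x) = x - (α^∨, x) α`. -/
noncomputable def reflVec (α x : E) : E := x - ⟪coroot α, x⟫ • α

/-- `Φ` is a (finite, not necessarily reduced) root system in `E`. -/
def IsRootSystem (Φ : Set E) : Prop :=
  Φ.Finite ∧ (0 : E) ∉ Φ ∧ Submodule.span ℝ Φ = ⊤ ∧
    (∀ α ∈ Φ, ∀ β ∈ Φ, reflVec α β ∈ Φ) ∧
    ∀ α ∈ Φ, ∀ β ∈ Φ, ∃ n : ℤ, ⟪coroot α, β⟫ = (n : ℝ)

/-- `Φ` is reduced: no root is half of another root. -/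
def IsReducedRS (Φ : Set E) : Prop := ∀ α ∈ Φ, (2⁻¹ : ℝ) • α ∉ Φ

/-- `Φ` is irreducible: nonempty and not a disjoint union of two nonempty
mutually orthogonal subsets. -/
def IsIrreducibleRS (Φ : Set E) : Prop :=
  Φ.Nonempty ∧
    ¬∃ Φ₁ Φ₂ : Set E, Φ₁.Nonempty ∧ Φ₂.Nonempty ∧ Φ₁ ∪ Φ₂ = Φ ∧ Disjoint Φ₁ Φ₂ ∧
      ∀ u ∈ Φ₁, ∀ v ∈ Φ₂, ⟪u, v⟫ = 0

/-- `Δ` is a basis (a set of simple roots) of the root system `Φ`: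
it is a vector space basis of `E`, and every root is a linear combination of `Δ`
whose coefficients are all nonnegative integers or all nonpositive integers. -/
def IsBaseRS (Φ : Set E) (Δ : Finset E) : Prop :=
  ↑Δ ⊆ Φ ∧ LinearIndependent ℝ (fun α : {x : E // x ∈ Δ} => (α : E)) ∧
    Submodule.span ℝ (Δ : Set E) = ⊤ ∧
    ∀ β ∈ Φ, ∃ c : E → ℤ, ((∀ α, 0 ≤ c α) ∨ (∀ α, c α ≤ 0)) ∧
      β = ∑ α ∈ Δ, (c α : ℝ) • α

/-- `ω` belongs to the Weyl group of `Φ`: it is a product of reflections in roots. -/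
def InWeylGroup (Φ : Set E) (ω : E ≃ₗᵢ[ℝ] E) : Prop :=
  ∃ l : List E, (∀ α ∈ l, α ∈ Φ) ∧ ∀ x : E, ω x = l.foldr reflVec x

/-- The average `x^ω = (1/o(ω)) Σ_{t=1}^{o(ω)} ω^t(x)`, where `o(ω)` is the order of `ω`. -/
noncomputable def avg (ω : E ≃ₗᵢ[ℝ] E) (x : E) : E :=
  (orderOf ω : ℝ)⁻¹ • ∑ t ∈ Finset.range (orderOf ω), (ω ^ (t + 1)) x

/-- The fixed-point set `E^ω`. -/
def fixedSet (ω : E ≃ₗᵢ[ℝ] E) : Set E := {x | ω x = x}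

/-- The fixed-point subspace `E^ω`. -/
def fixedSubmodule (ω : E ≃ₗᵢ[ℝ] E) : Submodule ℝ E :=
  LinearMap.ker ((ω.toLinearEquiv : E →ₗ[ℝ] E) - LinearMap.id)

/-- The folded root system `Φ_re^ω = {β^ω : β ∈ Φ, β^ω ≠ 0}`. -/
noncomputable def foldedRoots (Φ : Set E) (ω : E ≃ₗᵢ[ℝ] E) : Set E :=
  {v | v ≠ 0 ∧ ∃ β ∈ Φ, avg ω β = v}

/-- The `⟨ω⟩`-orbit `O(β) = {ω^t(β) : t ∈ ℤ}`. -/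
def orbitOf (ω : E ≃ₗᵢ[ℝ] E) (β : E) : Set E := {γ | ∃ t : ℤ, (ω ^ t) β = γ}

/-- `N(β) = {γ ∈ O(β) : γ ≠ ±β, (β,γ) ≠ 0}`. -/
def nbrOf (ω : E ≃ₗᵢ[ℝ] E) (β : E) : Set E :=
  {γ | γ ∈ orbitOf ω β ∧ γ ≠ β ∧ γ ≠ -β ∧ ⟪β, γ⟫ ≠ 0}


/-- `Δ^ω`: the averages of the simple roots whose `⟨ω⟩`-orbit avoids `α₀ = -htilde`. -/
noncomputable def simpleAvg (Δ : Finset E) (htilde : E) (ω : E ≃ₗᵢ[ℝ] E) : Set E :=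
  {v | ∃ α ∈ (Δ : Set E), -htilde ∉ orbitOf ω α ∧ avg ω α = v}

/-- `π̄_S = (Σ_{α ∈ S} ϖ_α^∨)^ω` for a subset `S` of `Δ₀`. -/
noncomputable def pibar (ω : E ≃ₗᵢ[ℝ] E) (ϖ : E → E) (S : Set E) : E :=
  avg ω (∑ᶠ γ ∈ S, ϖ γ)

end Folding


open Folding

namespace Folding

section Average

variable {E : Type*} [NormedAddCommGroup E] [InnerProductSpace ℝ E] {ω : E ≃ₗᵢ[ℝ] E}

lemma avg_add (x y : E) : avg ω (x + y) = avg ω x + avg ω y := by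
  simp [avg, Finset.sum_add_distrib]

lemma avg_smul (c : ℝ) (x : E) : avg ω (c • x) = c • avg ω x := by
  simp [avg, ← Finset.smul_sum, smul_comm c]

/-- The averaging operator as a linear map. -/
noncomputable def avgLin (ω : E ≃ₗᵢ[ℝ] E) : E →ₗ[ℝ] E where
  toFun := avg ω
  map_add' := avg_add
  map_smul' := avg_smul

@[simp] lemma avgLin_apply (x : E) : avgLin ω x = avg ω x := rfl

lemma avg_neg (x : E) : avg ω (-x) = -avg ω x := map_neg (avgLin ω) x

lemma avg_map (x : E) : avg ω (ω x) = avg ω x := by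
  unfold avg
  congr 1
  have h : ∀ t, (ω ^ (t + 1)) (ω x) = (ω ^ (t + 2)) x := fun t => by
    rw [pow_succ ω (t + 1)]; rfl
  have h1 : (ω ^ (orderOf ω + 1)) x = (ω ^ 1) x := by
    rw [pow_succ, pow_orderOf_eq_one, one_mul, pow_one]
  have := Finset.sum_range_succ (fun t => (ω ^ (t + 1)) x) (orderOf ω)
  rw [Finset.sum_range_succ'] at this
  simp only [h]
  rw [h1] at this
  simpa using this

lemma map_avg (x : E) : ω (avg ω x) = avg ω x := by
  conv_rhs => rw [← avg_map x]
  simp only [avg, map_smul, map_sum]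
  congr 1
  refine Finset.sum_congr rfl fun t _ => ?_
  change (ω * ω ^ (t + 1)) (x) = (ω ^ (t + 1) * ω) x
  rw [← pow_succ, ← pow_succ']

lemma pow_apply_of_fixed {x : E} (hx : ω x = x) (k : ℕ) : (ω ^ k) x = x := by
  induction k with
  | zero => simp
  | succ k ih =>
    rw [pow_succ]
    change (ω ^ k) (ω x) = x
    rw [hx, ih]

lemma avg_of_fixed (hω : IsOfFinOrder ω) {x : E} (hx : ω x = x) : avg ω x = x := by
  have h : (orderOf ω : ℝ) ≠ 0 := by
    exact_mod_cast hω.orderOf_pos.ne'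
  simp [avg, pow_apply_of_fixed hx, ← Nat.cast_smul_eq_nsmul ℝ, smul_smul, h]

lemma inner_avg_of_fixed (hω : IsOfFinOrder ω) (x : E) {y : E} (hy : ω y = y) :
    ⟪avg ω x, y⟫ = ⟪x, y⟫ := by
  have h : (orderOf ω : ℝ) ≠ 0 := by
    exact_mod_cast hω.orderOf_pos.ne'
  have h2 : ∀ t : ℕ, ⟪(ω ^ (t + 1)) x, y⟫ = ⟪x, y⟫ := fun t => by
    conv_lhs => rw [← pow_apply_of_fixed hy (t + 1)]
    exact LinearIsometryEquiv.inner_map_map _ _ _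
  simp [avg, inner_smul_left, sum_inner, h2, h]

lemma avg_zpow (t : ℤ) (x : E) : avg ω ((ω ^ t) x) = avg ω x := by
  induction t with
  | zero => simp
  | succ k ih => rw [add_comm, zpow_one_add]; exact (avg_map _).trans ih
  | pred k ih =>
    rw [← ih, ← avg_map ((ω ^ (-(k : ℤ) - 1)) x)]
    congr 1
    change (ω * ω ^ (-(k : ℤ) - 1)) x = _
    rw [← zpow_one_add]
    congr 2
    ring

end Average

section Orbit

variable {E : Type*} [NormedAddCommGroup E] [InnerProductSpace ℝ E] {ω : E ≃ₗᵢ[ℝ] E}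

lemma self_mem_orbitOf (β : E) : β ∈ orbitOf ω β := ⟨0, by simp⟩

lemma avg_of_mem_orbitOf {β γ : E} (h : γ ∈ orbitOf ω β) : avg ω γ = avg ω β := by
  obtain ⟨t, rfl⟩ := h
  exact avg_zpow t β

lemma inner_self_of_mem_orbitOf {β γ : E} (h : γ ∈ orbitOf ω β) : ⟪γ, γ⟫ = ⟪β, β⟫ := by
  obtain ⟨t, rfl⟩ := h
  exact LinearIsometryEquiv.inner_map_map _ _ _

lemma orbitOf_eq {β γ : E} (h : γ ∈ orbitOf ω β) : orbitOf ω γ = orbitOf ω β := by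
  obtain ⟨t, rfl⟩ := h
  ext δ
  constructor
  · rintro ⟨s, rfl⟩
    exact ⟨s + t, by rw [zpow_add]; rfl⟩
  · rintro ⟨s, rfl⟩
    refine ⟨s - t, ?_⟩
    change (ω ^ (s - t) * ω ^ t) β = _
    rw [← zpow_add, sub_add_cancel]

lemma zpow_mem_orbitOf (t : ℤ) {β γ : E} (h : γ ∈ orbitOf ω β) : (ω ^ t) γ ∈ orbitOf ω β := by
  rw [← orbitOf_eq h]
  exact ⟨t, rfl⟩

/-- The sum over a finite orbit is the cardinality times the average. -/
lemma sum_orbit (hω : IsOfFinOrder ω) {β : E} (O : Finset E) (hO : (O : Set E) = orbitOf ω β) :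
    ∑ γ ∈ O, γ = (O.card : ℝ) • avg ω β := by
  have hmem : ∀ γ, γ ∈ O ↔ γ ∈ orbitOf ω β := fun γ => by rw [← hO]; rfl
  have hfix : ω (∑ γ ∈ O, γ) = ∑ γ ∈ O, γ := by
    rw [map_sum]
    refine Finset.sum_bij (fun γ _ => ω γ) ?_ ?_ ?_ ?_
    · intro γ hγ
      have := zpow_mem_orbitOf 1 ((hmem γ).1 hγ)
      exact (hmem _).2 (by simpa using this)
    · intro a _ b _ hab
      exact ω.injective hab
    · intro γ hγ
      refine ⟨(ω ^ (-1 : ℤ)) γ, (hmem _).2 (zpow_mem_orbitOf _ ((hmem γ).1 hγ)), ?_⟩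
      change (ω * ω ^ (-1 : ℤ)) γ = γ
      simp
    · intros; rfl
  rw [← avg_of_fixed hω hfix, ← avgLin_apply, map_sum,
    Finset.sum_congr rfl fun γ hγ => (avgLin_apply γ).trans (avg_of_mem_orbitOf ((hmem γ).1 hγ)),
    Finset.sum_const, Nat.cast_smul_eq_nsmul]

lemma card_mul_inner_avg (hω : IsOfFinOrder ω) {β : E} (O : Finset E)
    (hO : (O : Set E) = orbitOf ω β) :
    (O.card : ℝ) * ⟪avg ω β, avg ω β⟫ = ∑ γ ∈ O, ⟪β, γ⟫ := by
  rw [inner_avg_of_fixed hω _ (map_avg β), ← inner_sum, sum_orbit hω O hO, inner_smul_right]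

/-- `⟨ω⟩`-orbits with pairwise orthogonal elements. -/
def OrthOrbit (ω : E ≃ₗᵢ[ℝ] E) (θ : E) : Prop :=
  ∀ γ ∈ orbitOf ω θ, γ ≠ θ → ⟪θ, γ⟫ = 0

lemma OrthOrbit.of_mem {θ δ : E} (h : OrthOrbit ω θ) (hδ : δ ∈ orbitOf ω θ) : OrthOrbit ω δ := by
  intro γ hγ hne
  rw [orbitOf_eq hδ] at hγ
  obtain ⟨t, rfl⟩ := hδ
  have hγ' : (ω ^ t) ((ω ^ (-t)) γ) = γ := by
    change (ω ^ t * ω ^ (-t)) γ = γ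
    rw [← zpow_add]; simp
  rw [← hγ', LinearIsometryEquiv.inner_map_map]
  refine h _ (zpow_mem_orbitOf _ hγ) fun h' => hne ?_
  rw [← hγ', h']

lemma sum_coroot_inner (hω : IsOfFinOrder ω) {θ : E} (hθ : avg ω θ ≠ 0) (h : OrthOrbit ω θ)
    (O : Finset E) (hO : (O : Set E) = orbitOf ω θ) (x : E) :
    ∑ γ ∈ O, ⟪coroot γ, x⟫ = ⟪coroot (avg ω θ), avg ω x⟫ := by
  have hmem : ∀ γ, γ ∈ O ↔ γ ∈ orbitOf ω θ := fun γ => by rw [← hO]; rfl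
  have hθO : θ ∈ O := (hmem θ).2 (self_mem_orbitOf θ)
  have h1 : (O.card : ℝ) * ⟪avg ω θ, avg ω θ⟫ = ⟪θ, θ⟫ := by
    rw [card_mul_inner_avg hω O hO]
    exact Finset.sum_eq_single_of_mem θ hθO fun γ hγ => h γ ((hmem γ).1 hγ)
  have h2 : ∑ γ ∈ O, ⟪coroot γ, x⟫ = 2 / ⟪θ, θ⟫ * ((O.card : ℝ) * ⟪avg ω θ, x⟫) := by
    rw [← real_inner_smul_left, ← sum_orbit hω O hO, sum_inner, Finset.mul_sum]
    refine Finset.sum_congr rfl fun γ hγ => ?_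
    rw [coroot, real_inner_smul_left, inner_self_of_mem_orbitOf ((hmem γ).1 hγ)]
  have h3 : ⟪avg ω θ, avg ω x⟫ = ⟪avg ω θ, x⟫ := by
    rw [real_inner_comm, inner_avg_of_fixed hω _ (map_avg θ), real_inner_comm]
  have h4 : ⟪avg ω θ, avg ω θ⟫ ≠ 0 := inner_self_ne_zero.2 hθ
  have h5 : (O.card : ℝ) ≠ 0 := by
    exact_mod_cast (Finset.card_pos.2 ⟨θ, hθO⟩).ne'
  rw [h2, coroot, real_inner_smul_left, h3, ← h1]
  field_simp

end Orbit

section Reflections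

variable {E : Type*} [NormedAddCommGroup E] [InnerProductSpace ℝ E]

lemma coroot_smul {c : ℝ} (hc : c ≠ 0) (u : E) : coroot (c • u) = c⁻¹ • coroot u := by
  simp only [coroot, smul_smul, real_inner_smul_left, real_inner_smul_right]
  congr 1
  field_simp

lemma reflVec_smul {c : ℝ} (hc : c ≠ 0) (u x : E) : reflVec (c • u) x = reflVec u x := by
  simp [reflVec, coroot_smul hc, real_inner_smul_left, smul_smul, mul_comm, hc]

lemma inner_coroot_self {u : E} (hu : u ≠ 0) : ⟪coroot u, u⟫ = 2 := by
  have : ⟪u, u⟫ ≠ 0 := inner_self_ne_zero.2 hu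
  rw [coroot, real_inner_smul_left]
  field_simp

lemma reflVec_ne_zero {u v : E} (hu : u ≠ 0) (hv : v ≠ 0) : reflVec u v ≠ 0 := by
  intro h
  have h1 : v = ⟪coroot u, v⟫ • u := sub_eq_zero.1 h
  have h2 : ⟪coroot u, v⟫ = 2 * ⟪coroot u, v⟫ := by
    conv_lhs => rw [h1, real_inner_smul_right, inner_coroot_self hu, mul_comm]
  have h3 : ⟪coroot u, v⟫ = 0 := by linarith
  rw [h3, zero_smul] at h1
  exact hv h1

variable {Φ : Set E}

lemma IsRootSystem.ne_zero (hΦ : IsRootSystem Φ) {β : E} (hβ : β ∈ Φ) : β ≠ 0 :=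
  fun h => hΦ.2.1 (h ▸ hβ)

lemma IsRootSystem.neg_mem (hΦ : IsRootSystem Φ) {β : E} (hβ : β ∈ Φ) : -β ∈ Φ := by
  have h := hΦ.2.2.2.1 β hβ β hβ
  rw [reflVec, inner_coroot_self (hΦ.ne_zero hβ), two_smul] at h
  simpa using h

/-- Composing the reflections in pairwise orthogonal roots preserves the root system. -/
lemma IsRootSystem.sub_sum_mem (hΦ : IsRootSystem Φ) {x : E} (hx : x ∈ Φ) (S : Finset E)
    (hS : ∀ γ ∈ S, γ ∈ Φ) (horth : ∀ γ ∈ S, ∀ δ ∈ S, γ ≠ δ → ⟪γ, δ⟫ = 0) :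
    x - ∑ γ ∈ S, ⟪coroot γ, x⟫ • γ ∈ Φ := by
  classical
  induction S using Finset.induction_on with
  | empty => simpa using hx
  | insert a S ha ih =>
    have ih' := ih (fun γ hγ => hS γ (Finset.mem_insert_of_mem hγ))
      fun γ hγ δ hδ => horth γ (Finset.mem_insert_of_mem hγ) δ (Finset.mem_insert_of_mem hδ)
    have h := hΦ.2.2.2.1 a (hS a (Finset.mem_insert_self a S)) _ ih'
    have h0 : ⟪coroot a, ∑ γ ∈ S, ⟪coroot γ, x⟫ • γ⟫ = 0 := by
      rw [inner_sum]
      refine Finset.sum_eq_zero fun γ hγ => ?_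
      rw [real_inner_smul_right, coroot.eq_def a, real_inner_smul_left,
        horth a (Finset.mem_insert_self a S) γ (Finset.mem_insert_of_mem hγ)
          (fun h => ha (h ▸ hγ))]
      simp
    rw [reflVec, inner_sub_right, h0, sub_zero] at h
    rw [Finset.sum_insert ha]
    convert h using 1
    abel

/-- Two roots of equal length which are not proportional have Cartan integer `-1`, `0` or `1`. -/
lemma IsRootSystem.cartan_of_norm_eq (hΦ : IsRootSystem Φ) {β γ : E} (hβ : β ∈ Φ) (hγ : γ ∈ Φ)
    (hn : ⟪γ, γ⟫ = ⟪β, β⟫) (h1 : γ ≠ β) (h2 : γ ≠ -β) :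
    (2 * ⟪β, γ⟫ = ⟪β, β⟫ ∧ γ - β ∈ Φ) ∨ ⟪β, γ⟫ = 0 ∨
      (2 * ⟪β, γ⟫ = -⟪β, β⟫ ∧ β + γ ∈ Φ) := by
  obtain ⟨n, hnn⟩ := hΦ.2.2.2.2 β hβ γ hγ
  have hpos : 0 < ⟪β, β⟫ := real_inner_self_pos.2 (hΦ.ne_zero hβ)
  have hr := hΦ.2.2.2.1 β hβ γ hγ
  rw [reflVec, hnn] at hr
  have h3 : 2 * ⟪β, γ⟫ = n * ⟪β, β⟫ := by
    rw [← hnn, coroot, real_inner_smul_left]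
    field_simp
  have h4 : 0 < ⟪γ - β, γ - β⟫ := real_inner_self_pos.2 (sub_ne_zero.2 h1)
  have h5 : 0 < ⟪γ + β, γ + β⟫ := real_inner_self_pos.2 fun h => h2 (eq_neg_of_add_eq_zero_left h)
  simp only [inner_sub_left, inner_sub_right, inner_add_left, inner_add_right, hn,
    real_inner_comm β γ] at h4 h5
  rw [real_inner_comm γ β] at h3
  have h6 : (n : ℝ) < 2 := by
    by_contra! h
    nlinarith [real_inner_comm β γ]
  have h7 : (-2 : ℝ) < n := by
    by_contra! h
    nlinarith [real_inner_comm β γ]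
  have h6' : n < 2 := by exact_mod_cast h6
  have h7' : -2 < n := by exact_mod_cast h7
  rw [real_inner_comm β γ] at h3
  have : n = -1 ∨ n = 0 ∨ n = 1 := by omega
  rcases this with rfl | rfl | rfl
  · refine Or.inr (Or.inr ⟨by simpa using h3, ?_⟩)
    simpa [add_comm] using hr
  · refine Or.inr (Or.inl ?_)
    simpa using h3
  · refine Or.inl ⟨by simpa using h3, ?_⟩
    simpa using hr

end Reflections

section Folded

variable {E : Type*} [NormedAddCommGroup E] [InnerProductSpace ℝ E] {Φ : Set E} {ω : E ≃ₗᵢ[ℝ] E}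

lemma isOfFinOrder_of_mapsTo (hΦ : IsRootSystem Φ) (hmaps : ∀ x ∈ Φ, ω x ∈ Φ) :
    IsOfFinOrder ω := by
  have hpow : ∀ (k : ℕ), ∀ x ∈ Φ, (ω ^ k) x ∈ Φ := by
    intro k
    induction k with
    | zero => intro x hx; simpa using hx
    | succ k ih => intro x hx; rw [pow_succ]; exact ih _ (hmaps x hx)
  have : Finite Φ := hΦ.1
  by_contra hinf
  have hinj := injective_pow_iff_not_isOfFinOrder.2 hinf
  obtain ⟨i, j, hij, he⟩ := Finite.exists_ne_map_eq_of_infinite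
    fun (k : ℕ) (x : Φ) => (⟨(ω ^ k) x, hpow k x x.2⟩ : Φ)
  refine hij (hinj ?_)
  have hlin : ((ω ^ i).toLinearEquiv : E →ₗ[ℝ] E) = ((ω ^ j).toLinearEquiv : E →ₗ[ℝ] E) := by
    refine LinearMap.ext_on hΦ.2.2.1 fun x hx => ?_
    exact congrArg Subtype.val (congrFun he ⟨x, hx⟩)
  ext x
  exact LinearMap.congr_fun hlin x

lemma orbitOf_induction (hω : IsOfFinOrder ω) {P : E → Prop} (hP : ∀ x, P x → P (ω x)) {β γ : E}
    (hβ : P β) (hγ : γ ∈ orbitOf ω β) : P γ := by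
  obtain ⟨t, rfl⟩ := hγ
  obtain ⟨k, hk⟩ := hω.mem_powers_iff_mem_zpowers.2 (⟨t, rfl⟩ : ω ^ t ∈ Subgroup.zpowers ω)
  replace hk : ω ^ k = ω ^ t := hk
  rw [← hk]
  clear hk
  induction k with
  | zero => simpa using hβ
  | succ k ih => rw [pow_succ']; exact hP _ ih

/-- If no two elements of an orbit differ by a root, then any nonzero averaged root is, up to
a factor `1` or `2`, the average of a root with orthogonal orbit. -/
lemma exists_orthOrbit (hΦ : IsRootSystem Φ) (hmaps : ∀ x ∈ Φ, ω x ∈ Φ)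
    (hdiff : ∀ β ∈ Φ, ∀ γ ∈ orbitOf ω β, γ - β ∉ Φ) {β : E} (hβ : β ∈ Φ) (hβ0 : avg ω β ≠ 0) :
    ∃ θ ∈ Φ, OrthOrbit ω θ ∧ (avg ω θ = avg ω β ∨ avg ω θ = (2 : ℝ) • avg ω β) := by
  have hω := isOfFinOrder_of_mapsTo hΦ hmaps
  have horb : ∀ δ ∈ orbitOf ω β, δ ∈ Φ := fun δ => orbitOf_induction hω hmaps hβ
  have hcart : ∀ δ ∈ orbitOf ω β, ∀ ε ∈ orbitOf ω β, ε ≠ δ →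
      ⟪δ, ε⟫ = 0 ∨ (2 * ⟪δ, ε⟫ = -⟪β, β⟫ ∧ δ + ε ∈ Φ) := by
    intro δ hδ ε hε hne
    have hne' : ε ≠ -δ := by
      intro h
      have h1 := avg_of_mem_orbitOf hε
      rw [h, avg_neg, avg_of_mem_orbitOf hδ] at h1
      have h2 : (2 : ℝ) • avg ω β = 0 := by
        rw [two_smul]
        nth_rewrite 1 [← h1]
        exact neg_add_cancel _
      exact hβ0 ((smul_eq_zero.1 h2).resolve_left two_ne_zero)
    have hn := inner_self_of_mem_orbitOf hδ
    have := hΦ.cartan_of_norm_eq (horb δ hδ) (horb ε hε)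
      ((inner_self_of_mem_orbitOf hε).trans hn.symm) hne hne'
    rw [hn] at this
    rcases this with ⟨-, h⟩ | h
    · exact absurd h (hdiff δ (horb δ hδ) ε (by rwa [orbitOf_eq hδ]))
    · exact h
  have hpos : 0 < ⟪β, β⟫ := real_inner_self_pos.2 (hΦ.ne_zero hβ)
  have huniq : ∀ δ ∈ orbitOf ω β, ∀ ε ∈ orbitOf ω β, ∀ ε' ∈ orbitOf ω β, ε ≠ δ → ε' ≠ δ →
      ⟪δ, ε⟫ ≠ 0 → ⟪δ, ε'⟫ ≠ 0 → ε = ε' := by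
    classical
    intro δ hδ ε hε ε' hε' hne hne' h0 h0'
    by_contra hεε
    have hfin : (orbitOf ω β).Finite := hΦ.1.subset horb
    have hO : (hfin.toFinset : Set E) = orbitOf ω δ := by
      rw [orbitOf_eq hδ]; exact hfin.coe_toFinset
    have hsum := card_mul_inner_avg hω _ hO
    have hcard : (0 : ℝ) < hfin.toFinset.card := by
      exact_mod_cast Finset.card_pos.2 ⟨β, hfin.mem_toFinset.2 (self_mem_orbitOf β)⟩
    have havg : 0 < ⟪avg ω δ, avg ω δ⟫ := by
      rw [avg_of_mem_orbitOf hδ]; exact real_inner_self_pos.2 hβ0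
    have h1 := ((hcart δ hδ ε hε hne).resolve_left h0).1
    have h2 := ((hcart δ hδ ε' hε' hne').resolve_left h0').1
    have hle : ∑ γ ∈ hfin.toFinset, ⟪δ, γ⟫ ≤ ∑ γ ∈ ({δ, ε, ε'} : Finset E), ⟪δ, γ⟫ := by
      rw [← Finset.sum_sdiff (s₁ := ({δ, ε, ε'} : Finset E)) (s₂ := hfin.toFinset)]
      · refine add_le_of_nonpos_left (Finset.sum_nonpos fun γ hγ => ?_)
        simp only [Finset.mem_sdiff, Set.Finite.mem_toFinset, Finset.mem_insert,
          Finset.mem_singleton, not_or] at hγ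
        rcases hcart δ hδ γ hγ.1 hγ.2.1 with h | ⟨h, -⟩ <;> linarith
      · intro γ hγ
        simp only [Finset.mem_insert, Finset.mem_singleton] at hγ
        rw [hfin.mem_toFinset]
        rcases hγ with rfl | rfl | rfl <;> assumption
    rw [Finset.sum_insert (by simp [hne.symm, hne'.symm]), Finset.sum_pair hεε,
      inner_self_of_mem_orbitOf hδ] at hle
    have := mul_pos hcard havg
    linarith
  by_cases horth : OrthOrbit ω β
  · exact ⟨β, hβ, horth, Or.inl rfl⟩
  simp only [OrthOrbit, not_forall] at horth
  obtain ⟨γ, hγ, hne, h0⟩ := horth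
  have hββ := self_mem_orbitOf (ω := ω) β
  have h0' : ⟪γ, β⟫ ≠ 0 := by rwa [real_inner_comm]
  refine ⟨β + γ, ((hcart β hββ γ hγ hne).resolve_left h0).2, ?_, Or.inr ?_⟩
  · rintro _ ⟨t, rfl⟩ hneθ
    have hδ : (ω ^ t) β ∈ orbitOf ω β := zpow_mem_orbitOf t hββ
    have hε : (ω ^ t) γ ∈ orbitOf ω β := zpow_mem_orbitOf t hγ
    have hδε : (ω ^ t) γ ≠ (ω ^ t) β := fun h => hne ((ω ^ t).injective h)
    have hi : ⟪(ω ^ t) β, (ω ^ t) γ⟫ ≠ 0 := by rwa [LinearIsometryEquiv.inner_map_map]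
    have hi' : ⟪(ω ^ t) γ, (ω ^ t) β⟫ ≠ 0 := by rwa [real_inner_comm]
    rw [map_add] at hneθ ⊢
    generalize (ω ^ t) β = δ at *
    generalize (ω ^ t) γ = ε at *
    have e1 : δ ≠ β := by
      rintro rfl
      rw [huniq δ hδ ε hε γ hγ hδε hne hi h0] at hneθ
      exact hneθ rfl
    have e2 : δ ≠ γ := by
      rintro rfl
      rw [huniq δ hδ ε hε β hββ hδε hne.symm hi h0'] at hneθ
      exact hneθ (add_comm _ _)
    have e3 : ε ≠ β := by
      rintro rfl
      rw [huniq ε hε δ hδ γ hγ hδε.symm hne hi' h0] at hneθ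
      exact hneθ (add_comm _ _)
    have e4 : ε ≠ γ := by
      rintro rfl
      rw [huniq ε hε δ hδ β hββ hδε.symm hne.symm hi' h0'] at hneθ
      exact hneθ rfl
    have z1 : ⟪β, δ⟫ = 0 := by
      by_contra h; exact e2 (huniq β hββ δ hδ γ hγ e1 hne h h0)
    have z2 : ⟪β, ε⟫ = 0 := by
      by_contra h; exact e4 (huniq β hββ ε hε γ hγ e3 hne h h0)
    have z3 : ⟪γ, δ⟫ = 0 := by
      by_contra h; exact e1 (huniq γ hγ δ hδ β hββ e2 hne.symm h h0')
    have z4 : ⟪γ, ε⟫ = 0 := by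
      by_contra h; exact e3 (huniq γ hγ ε hε β hββ e4 hne.symm h h0')
    simp [inner_add_left, inner_add_right, z1, z2, z3, z4]
  · rw [avg_add, avg_of_mem_orbitOf hγ, two_smul]

lemma folded_of_orthOrbit (hΦ : IsRootSystem Φ) (hmaps : ∀ x ∈ Φ, ω x ∈ Φ) {θ : E} (hθ : θ ∈ Φ)
    (hθ0 : avg ω θ ≠ 0) (horth : OrthOrbit ω θ) {v : E} (hv : v ∈ foldedRoots Φ ω) :
    reflVec (avg ω θ) v ∈ foldedRoots Φ ω ∧ ∃ n : ℤ, ⟪coroot (avg ω θ), v⟫ = (n : ℝ) := by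
  have hω := isOfFinOrder_of_mapsTo hΦ hmaps
  have horb : ∀ δ ∈ orbitOf ω θ, δ ∈ Φ := fun δ => orbitOf_induction hω hmaps hθ
  have hfin : (orbitOf ω θ).Finite := hΦ.1.subset horb
  obtain ⟨hv0, x, hx, rfl⟩ := hv
  have hsum := sum_coroot_inner hω hθ0 horth hfin.toFinset hfin.coe_toFinset x
  refine ⟨⟨reflVec_ne_zero hθ0 hv0, _, hΦ.sub_sum_mem hx hfin.toFinset
    (fun γ hγ => horb γ (hfin.mem_toFinset.1 hγ)) ?_, ?_⟩, ?_⟩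
  · intro γ hγ δ hδ hne
    rw [hfin.mem_toFinset] at hγ hδ
    exact horth.of_mem hγ δ (by rwa [orbitOf_eq hγ]) hne.symm
  · rw [← avgLin_apply, map_sub, map_sum, reflVec, ← hsum, Finset.sum_smul, avgLin_apply]
    congr 1
    refine Finset.sum_congr rfl fun γ hγ => ?_
    rw [map_smul, avgLin_apply, avg_of_mem_orbitOf (hfin.mem_toFinset.1 hγ)]
  · choose! n hn using fun γ (hγ : γ ∈ Φ) => hΦ.2.2.2.2 γ hγ x hx
    refine ⟨∑ γ ∈ hfin.toFinset, n γ, ?_⟩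
    rw [← hsum, Int.cast_sum]
    exact Finset.sum_congr rfl fun γ hγ => hn γ (horb γ (hfin.mem_toFinset.1 hγ))

lemma span_foldedRoots (hω : IsOfFinOrder ω) (hΦ : Submodule.span ℝ Φ = ⊤) :
    Submodule.span ℝ (foldedRoots Φ ω) = fixedSubmodule ω := by
  have hmem : ∀ x, x ∈ fixedSubmodule ω ↔ ω x = x := fun x => by
    simp [fixedSubmodule, sub_eq_zero]
  refine le_antisymm (Submodule.span_le.2 ?_) fun x hx => ?_
  · rintro _ ⟨-, β, -, rfl⟩
    exact (hmem _).2 (map_avg β)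
  · rw [← avg_of_fixed hω ((hmem x).1 hx)]
    have hle : Submodule.span ℝ Φ ≤ (Submodule.span ℝ (foldedRoots Φ ω)).comap (avgLin ω) := by
      refine Submodule.span_le.2 fun β hβ => ?_
      by_cases h : avg ω β = 0
      · simp [h]
      · exact Submodule.subset_span ⟨h, β, hβ, rfl⟩
    exact hle (hΦ ▸ Submodule.mem_top : x ∈ Submodule.span ℝ Φ)

/-- Elements of an orbit of an automorphism of the extended Dynkin diagram never differ by a root:
their heights agree modulo the Coxeter number, which is larger than the height of any root. -/
lemma sub_notMem_of_mem_orbitOf {Δ : Finset E} {coeff : E → E → ℝ} {htilde : E}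
    (hΦ : IsRootSystem Φ) (hΔ : IsBaseRS Φ Δ) (hcoeff : ∀ β ∈ Φ, β = ∑ α ∈ Δ, coeff β α • α)
    (hht : htilde ∈ Φ)
    (hhighest : ∀ β ∈ Φ, β ≠ htilde → ∑ α ∈ Δ, coeff β α < ∑ α ∈ Δ, coeff htilde α)
    (hmaps : ∀ x ∈ Φ, ω x ∈ Φ) (hωΔ₀ : ⇑ω '' (↑Δ ∪ {-htilde}) = ↑Δ ∪ {-htilde}) :
    ∀ β ∈ Φ, ∀ γ ∈ orbitOf ω β, γ - β ∉ Φ := by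
  obtain ⟨-, hli, hspan, hint⟩ := hΔ
  let b : Module.Basis {x : E // x ∈ Δ} ℝ E := Module.Basis.mk hli (by
    rw [show Set.range (fun α : {x : E // x ∈ Δ} => (α : E)) = (Δ : Set E) by simp]
    exact hspan.ge)
  let ℓ : E →ₗ[ℝ] ℝ := b.constr ℝ fun _ => (1 : ℝ)
  have hℓ : ∀ α ∈ Δ, ℓ α = 1 := fun α hα => by
    have := b.constr_basis ℝ (fun _ => (1 : ℝ)) ⟨α, hα⟩
    rwa [Module.Basis.mk_apply] at this
  have hℓsum : ∀ c : E → ℝ, ℓ (∑ α ∈ Δ, c α • α) = ∑ α ∈ Δ, c α := fun c => by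
    rw [map_sum]
    exact Finset.sum_congr rfl fun α hα => by rw [map_smul, hℓ α hα, smul_eq_mul, mul_one]
  have hle : ∀ β ∈ Φ, ℓ β ≤ ℓ htilde := fun β hβ => by
    rcases eq_or_ne β htilde with rfl | hne
    · rfl
    · rw [hcoeff β hβ, hcoeff htilde hht, hℓsum, hℓsum]
      exact (hhighest β hβ hne).le
  have hne0 : ∀ β ∈ Φ, ℓ β ≠ 0 := fun β hβ h => by
    obtain ⟨c, hc, hβc⟩ := hint β hβ
    have h0 : ∑ α ∈ Δ, c α = 0 := by
      rw [hβc, hℓsum] at h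
      exact_mod_cast h
    have hc0 : ∀ α ∈ Δ, c α = 0 := by
      rcases hc with hc | hc
      · exact (Finset.sum_eq_zero_iff_of_nonneg fun α _ => hc α).1 h0
      · exact (Finset.sum_eq_zero_iff_of_nonpos fun α _ => hc α).1 h0
    refine hΦ.ne_zero hβ ?_
    rw [hβc]
    exact Finset.sum_eq_zero fun α hα => by rw [hc0 α hα]; simp
  have hω : IsOfFinOrder ω := isOfFinOrder_of_mapsTo hΦ hmaps
  have hsimple : ∀ α ∈ Δ, ∃ m : ℤ, ℓ (ω α) = 1 + m * (ℓ htilde + 1) := fun α hα => by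
    have h : ω α ∈ (↑Δ ∪ {-htilde} : Set E) := hωΔ₀ ▸ Set.mem_image_of_mem _ (Or.inl hα)
    rcases h with h | h
    · exact ⟨0, by rw [hℓ _ h]; simp⟩
    · refine ⟨-1, ?_⟩
      rw [Set.mem_singleton_iff.1 h, map_neg]
      push_cast
      ring
  choose! m hm using hsimple
  have hstep : ∀ β ∈ Φ, ∃ k : ℤ, ℓ (ω β) = ℓ β + k * (ℓ htilde + 1) := fun β hβ => by
    obtain ⟨c, -, hβc⟩ := hint β hβ
    refine ⟨∑ α ∈ Δ, c α * m α, ?_⟩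
    rw [hβc, hℓsum, map_sum, map_sum]
    push_cast
    rw [Finset.sum_mul, ← Finset.sum_add_distrib]
    refine Finset.sum_congr rfl fun α hα => ?_
    rw [map_smul, map_smul, hm α hα, smul_eq_mul]
    ring
  intro β hβ γ hγ hmem
  obtain ⟨-, k, hk⟩ : γ ∈ Φ ∧ ∃ k : ℤ, ℓ γ = ℓ β + k * (ℓ htilde + 1) := by
    refine orbitOf_induction hω (P := fun γ => γ ∈ Φ ∧ ∃ k : ℤ, ℓ γ = ℓ β + k * (ℓ htilde + 1))
      ?_ ⟨hβ, 0, by simp⟩ hγ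
    rintro x ⟨hx, k, hk⟩
    obtain ⟨j, hj⟩ := hstep x hx
    refine ⟨hmaps x hx, k + j, ?_⟩
    rw [hj, hk]
    push_cast
    ring
  have h1 := hle _ hmem
  have h2 := hle _ (hΦ.neg_mem hmem)
  have h3 := hne0 _ hmem
  rw [map_neg] at h2
  rw [map_sub, hk, add_sub_cancel_left] at h1 h2 h3
  have hpos : 0 < ℓ htilde + 1 := by linarith
  have hk1 : (k : ℝ) < 1 := by
    by_contra! h
    nlinarith
  have hk2 : (-1 : ℝ) < k := by
    by_contra! h
    nlinarith
  have hk1' : k < 1 := by exact_mod_cast hk1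
  have hk2' : -1 < k := by exact_mod_cast hk2
  have : k = 0 := by omega
  simp [this] at h3

end Folded

end Folding

theorem folded_is_root_system
    {E : Type*} [NormedAddCommGroup E] [InnerProductSpace ℝ E] [FiniteDimensional ℝ E]
    (Φ : Set E) (Δ : Finset E) (coeff : E → E → ℝ) (htilde : E) (ω : E ≃ₗᵢ[ℝ] E)
    (hΦrs : IsRootSystem Φ) (hΦred : IsReducedRS Φ) (hΦirr : IsIrreducibleRS Φ)
    (hΔ : IsBaseRS Φ Δ)
    (hcoeff : ∀ β ∈ Φ, β = ∑ α ∈ Δ, coeff β α • α)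
    (hht : htilde ∈ Φ)
    (hhighest : ∀ β ∈ Φ, β ≠ htilde → ∑ α ∈ Δ, coeff β α < ∑ α ∈ Δ, coeff htilde α)
    (hωW : InWeylGroup Φ ω)
    (hωΔ₀ : ⇑ω '' (↑Δ ∪ {-htilde}) = ↑Δ ∪ {-htilde})
    (hω1 : ω ≠ 1) :
    (foldedRoots Φ ω).Finite ∧
      foldedRoots Φ ω ⊆ fixedSet ω ∧
      (0 : E) ∉ foldedRoots Φ ω ∧
      Submodule.span ℝ (foldedRoots Φ ω) = fixedSubmodule ω ∧
      (∀ u ∈ foldedRoots Φ ω, ∀ v ∈ foldedRoots Φ ω, reflVec u v ∈ foldedRoots Φ ω) ∧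
      ∀ u ∈ foldedRoots Φ ω, ∀ v ∈ foldedRoots Φ ω, ∃ n : ℤ, ⟪coroot u, v⟫ = (n : ℝ) := by
  have hmaps : ∀ x ∈ Φ, ω x ∈ Φ := by
    obtain ⟨l, hl, hlω⟩ := hωW
    intro x hx
    rw [hlω]
    clear hlω
    induction l with
    | nil => exact hx
    | cons a l ih =>
      exact hΦrs.2.2.2.1 a (hl a List.mem_cons_self) _
        (ih fun α hα => hl α (List.mem_cons_of_mem a hα))
  have hω := isOfFinOrder_of_mapsTo hΦrs hmaps
  have hdiff := sub_notMem_of_mem_orbitOf hΦrs hΔ hcoeff hht hhighest hmaps hωΔ₀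
  have key : ∀ u ∈ foldedRoots Φ ω, ∀ v ∈ foldedRoots Φ ω,
      reflVec u v ∈ foldedRoots Φ ω ∧ ∃ n : ℤ, ⟪coroot u, v⟫ = (n : ℝ) := by
    rintro _ ⟨hβ0, β, hβ, rfl⟩ v hv
    obtain ⟨θ, hθ, horth, h | h⟩ := exists_orthOrbit hΦrs hmaps hdiff hβ hβ0
    · rw [← h] at hβ0 ⊢
      exact folded_of_orthOrbit hΦrs hmaps hθ hβ0 horth hv
    · have hθ0 : avg ω θ ≠ 0 := h ▸ smul_ne_zero two_ne_zero hβ0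
      obtain ⟨h1, n, hn⟩ := folded_of_orthOrbit hΦrs hmaps hθ hθ0 horth hv
      rw [h, reflVec_smul two_ne_zero] at h1
      rw [h, coroot_smul two_ne_zero, real_inner_smul_left] at hn
      refine ⟨h1, 2 * n, ?_⟩
      push_cast
      linarith
  refine ⟨(hΦrs.1.image (avg ω)).subset ?_, ?_, fun h => h.1 rfl,
    span_foldedRoots hω hΦrs.2.2.1, fun u hu v hv => (key u hu v hv).1,
    fun u hu v hv => (key u hu v hv).2⟩
  · rintro _ ⟨-, β, hβ, rfl⟩
    exact ⟨β, hβ, rfl⟩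
  · rintro _ ⟨-, β, -, rfl⟩
    exact map_avg β
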